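/- Let Ω ⊂ ℝ² be a nonempty open bounded connected domain of class C² such that H(Ω) = Cut(Ω) =: S. Then S is either a singleton or a 1-dimensional manifold without boundary of class C², and Ω = {x ∈ ℝ² : d_S(x) < ρ_Ω}, where ρ_Ω := max over the closure of Ω of d_{∂Ω}. -/

import Mathlib

open Metric Set Real

noncomputable section

abbrev E2 := EuclideanSpace ℝ (Fin 2)

/-- The point of the Euclidean plane with coordinates `(a, b)`. -/
def pt (a b : ℝ) : E2 := (EuclideanSpace.equiv (Fin 2) ℝ).symm ![a, b]

/-- The set of closest points to `x` on the boundary of `Ω`. -/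
def projBd (Ω : Set E2) (x : E2) : Set E2 :=
  {y ∈ frontier Ω | dist x y = infDist x (frontier Ω)}

/-- The skeleton `Σ(Ω)`: points of `Ω` with more than one closest boundary point. -/
def skeleton (Ω : Set E2) : Set E2 :=
  {x ∈ Ω | ∃ y ∈ projBd Ω x, ∃ z ∈ projBd Ω x, y ≠ z}

/-- The cut locus `Cut(Ω)`: the closure of the skeleton. -/
def cutLocus (Ω : Set E2) : Set E2 := closure (skeleton Ω)

/-- The high ridge `H(Ω)`: the set where `d_{∂Ω}` attains its maximum over `closure Ω`. -/
def highRidge (Ω : Set E2) : Set E2 :=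
  {x ∈ closure Ω | ∀ z ∈ closure Ω, infDist z (frontier Ω) ≤ infDist x (frontier Ω)}

/-- `ρ_Ω`, the maximum of `d_{∂Ω}` over `closure Ω`. -/
def inradius (Ω : Set E2) : ℝ :=
  sSup ((fun z => infDist z (frontier Ω)) '' closure Ω)

/-- A planar domain is of class `C^k` if near each boundary point, in suitable orthonormal
coordinates, its boundary is the graph of a `C^k` function and the domain is the region
above the graph. -/
def IsCkDomain2 (k : ℕ∞) (Ω : Set E2) : Prop :=
  ∀ y ∈ frontier Ω, ∃ (e : E2 ≃ᵃⁱ[ℝ] E2) (U : Set E2) (g : ℝ → ℝ),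
    IsOpen U ∧ y ∈ U ∧ ContDiff ℝ k g ∧
    (∀ z ∈ U, z ∈ Ω ↔ g (e z 0) < e z 1) ∧
    (∀ z ∈ U, z ∈ frontier Ω ↔ g (e z 0) = e z 1)

/-- `S` is, near `p`, in suitable orthonormal coordinates (i.e. up to a rigid motion `e`),
the graph of a `C²` function over an open interval. -/
def IsC2GraphAt (S : Set E2) (p : E2) : Prop :=
  ∃ (e : E2 ≃ᵃⁱ[ℝ] E2) (U : Set E2) (g : ℝ → ℝ) (a b : ℝ),
    IsOpen U ∧ p ∈ U ∧ a < b ∧ ContDiff ℝ 2 g ∧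
    e '' (S ∩ U) = (fun t => pt t (g t)) '' Set.Ioo a b

section ClosestPoints

open Filter Topology

theorem eventually_forall_of_dist_eq {E : Type*} [PseudoMetricSpace E] {K : Set E}
    (hK : IsCompact K) {φ : E → ℝ} (hφ : Continuous φ) {W : Set (E × E)} (hW : IsOpen W) {s : E}
    (h : ∀ y ∈ K, dist s y = φ s → (s, y) ∈ W) :
    ∀ᶠ x in 𝓝 s, ∀ y ∈ K, dist x y = φ x → (x, y) ∈ W := by
  refine hK.eventually_forall_of_forall_eventually fun y hy => ?_
  by_cases hyW : (s, y) ∈ W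
  · filter_upwards [hW.mem_nhds hyW] with z hz _ using hz
  · have hne : dist s y ≠ φ s := fun hd => hyW (h y hy hd)
    have hop : IsOpen {z : E × E | dist z.1 z.2 ≠ φ z.1} :=
      isOpen_ne_fun (by fun_prop) (by fun_prop)
    filter_upwards [hop.mem_nhds (show ((s, y) : E × E) ∈ _ from hne)] with z hz hd
    exact absurd hd hz

/-- Upper semicontinuity of the closest-point map of a compact set. -/
theorem eventually_closest_mem {E : Type*} [PseudoMetricSpace E] {K : Set E} (hK : IsCompact K)
    {φ : E → ℝ} (hφ : Continuous φ) {W : Set E} (hW : IsOpen W) {s : E}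
    (h : ∀ y ∈ K, dist s y = φ s → y ∈ W) :
    ∀ᶠ x in 𝓝 s, ∀ y ∈ K, dist x y = φ x → y ∈ W :=
  eventually_forall_of_dist_eq hK hφ (hW.preimage continuous_snd) h

variable {E : Type*} [NormedAddCommGroup E] [InnerProductSpace ℝ E]

/-- At a point `w` with a unique closest point `y` in `K`, the distance function from `K` grows in
the direction `w - y` with slope arbitrarily close to `1`. -/
theorem eventually_infDist_ascent {K : Set E} (hK : IsCompact K) {w y : E} (hy : y ∈ K)
    (hwy : dist w y = infDist w K) (hpos : 0 < infDist w K)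
    (huniq : ∀ z ∈ K, dist w z = infDist w K → z = y) {c : ℝ} (hc0 : 0 < c) (hc1 : c < 1) :
    ∀ᶠ h in 𝓝[>] (0 : ℝ),
      infDist w K + c * (h * infDist w K) ≤ infDist (w + h • (w - y)) K := by
  set d := infDist w K with hd
  have hη : 0 < (1 - c) * d := mul_pos (by linarith) hpos
  have h1 := eventually_closest_mem hK (continuous_infDist_pt K)
    (isOpen_ball (x := y) (ε := (1 - c) * d)) (s := w) (fun z hz hzd => by
      rw [huniq z hz hzd]; exact mem_ball_self hη)
  have hcont : Tendsto (fun h : ℝ => w + h • (w - y)) (𝓝[>] 0) (𝓝 w) := by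
    have : Continuous (fun h : ℝ => w + h • (w - y)) := by fun_prop
    have h2 := this.tendsto 0
    simp only [zero_smul, add_zero] at h2
    exact h2.mono_left nhdsWithin_le_nhds
  filter_upwards [hcont.eventually h1, self_mem_nhdsWithin] with h hh hpos'
  have hpos' : 0 < h := hpos'
  obtain ⟨z, hz, hzd⟩ := hK.exists_infDist_eq_dist ⟨y, hy⟩ (w + h • (w - y))
  have hzy : dist z y < (1 - c) * d := hh z hz hzd.symm
  rw [hzd]
  have hwz : d ≤ ‖w - z‖ := by rw [← dist_eq_norm]; exact infDist_le_dist_of_mem hz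
  have hwy' : ‖w - y‖ = d := by rw [← dist_eq_norm]; exact hwy
  have hin : d * (c * d) ≤ inner ℝ (w - y) (w - z) := by
    have e1 : w - z = (w - y) - (z - y) := by abel
    rw [e1, inner_sub_right, real_inner_self_eq_norm_sq, hwy']
    have := real_inner_le_norm (w - y) (z - y)
    rw [hwy', ← dist_eq_norm z y] at this
    nlinarith
  rw [dist_eq_norm]
  have e2 : w + h • (w - y) - z = (w - z) + h • (w - y) := by abel
  rw [e2]
  refine le_of_sq_le_sq ?_ (norm_nonneg _)
  rw [norm_add_sq_real, inner_smul_right, norm_smul, hwy', real_inner_comm, Real.norm_eq_abs,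
    abs_of_pos hpos']
  have h3 : c ^ 2 * (h * d) ^ 2 ≤ (h * d) ^ 2 := by
    have : c ^ 2 ≤ 1 := by nlinarith
    nlinarith [sq_nonneg (h * d)]
  nlinarith [mul_le_mul_of_nonneg_left hin hpos'.le]

/-- If points near `s` that are closer to `K` than `s` have a unique closest point in `K`, then a
closest point of `s` that is isolated among the closest points of `s` is antipodal to every other
closest point of `s`. -/
theorem eq_midpoint_of_isolated_closest {K : Set E} (hK : IsCompact K) {s y z : E}
    (hs : 0 < infDist s K) (hy : y ∈ K) (hz : z ∈ K)
    (hsy : dist s y = infDist s K) (hsz : dist s z = infDist s K) (hzy : z ≠ y)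
    (hiso : ∀ᶠ y' in 𝓝 y, y' ∈ K → dist s y' = infDist s K → y' = y)
    (huniq : ∀ᶠ x in 𝓝 s, infDist x K < infDist s K →
      ∀ a ∈ K, ∀ b ∈ K, dist x a = infDist x K → dist x b = infDist x K → a = b) :
    s = midpoint ℝ y z := by
  by_contra hne
  set ρ := infDist s K with hρ
  obtain ⟨ε, hε, hiso⟩ := Metric.eventually_nhds_iff.1 hiso
  have hgap := eventually_closest_mem hK (continuous_infDist_pt K)
    (isOpen_ball.union (isClosed_closedBall (x := y) (ε := ε / 2)).isOpen_compl :
      IsOpen (ball y (ε / 3) ∪ (closedBall y (ε / 2))ᶜ)) (s := s) (fun a ha had => by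
      by_cases h : dist a y < ε
      · left; rw [hiso h ha had]; exact mem_ball_self (by linarith)
      · right; simp only [mem_compl_iff, mem_closedBall, not_le]; linarith)
  obtain ⟨δ, hδ, hball⟩ := Metric.eventually_nhds_iff.1 (hgap.and huniq)
  set u := y - s with hu
  set v := z - s with hv
  have hun : ‖u‖ = ρ := by rw [hu, ← dist_eq_norm, dist_comm]; exact hsy
  have hvn : ‖v‖ = ρ := by rw [hv, ← dist_eq_norm, dist_comm]; exact hsz
  have huv : 0 < ρ ^ 2 + inner ℝ u v := by
    have h0 : u + v ≠ 0 := by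
      intro h0
      apply hne
      rw [midpoint_eq_smul_add]
      have : y + z = (2 : ℝ) • s := by
        rw [two_smul, ← sub_eq_zero, ← h0]; simp only [hu, hv]; abel
      rw [this, smul_smul]; norm_num
    have h1 : 0 < ‖u + v‖ ^ 2 := by positivity
    rw [norm_add_sq_real, hun, hvn] at h1
    linarith
  obtain ⟨t, ht0, ht1⟩ : ∃ t : ℝ, 0 < t ∧ t < min 1 (min (δ / ρ) ((ρ ^ 2 + inner ℝ u v) / ρ ^ 2)) :=
    exists_between (lt_min one_pos (lt_min (by positivity) (by positivity)))
  have htone : t < 1 := ht1.trans_le (min_le_left _ _)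
  have htδ : t * ρ < δ := by
    rw [← lt_div_iff₀ hs]; exact ht1.trans_le ((min_le_right _ _).trans (min_le_left _ _))
  have htc : t * ρ ^ 2 < ρ ^ 2 + inner ℝ u v := by
    rw [← lt_div_iff₀ (by positivity)]
    exact ht1.trans_le ((min_le_right _ _).trans (min_le_right _ _))
  set m : ℝ → E := fun θ => (1 - θ) • u + θ • v with hm
  set x : ℝ → E := fun θ => s + t • m θ with hx
  have hxc : Continuous x := by simp only [hx, hm]; fun_prop
  have hmn : ∀ θ ∈ Icc (0 : ℝ) 1, ‖m θ‖ ≤ ρ := by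
    intro θ hθ
    refine (norm_add_le _ _).trans ?_
    rw [norm_smul, norm_smul, hun, hvn, Real.norm_eq_abs, Real.norm_eq_abs, abs_of_nonneg hθ.1,
      abs_of_nonneg (by linarith [hθ.2] : 0 ≤ 1 - θ)]
    linarith
  have hxs : ∀ θ ∈ Icc (0 : ℝ) 1, dist (x θ) s < δ := by
    intro θ hθ
    rw [dist_eq_norm]
    simp only [hx, add_sub_cancel_left, norm_smul, Real.norm_eq_abs, abs_of_pos ht0]
    exact (mul_le_mul_of_nonneg_left (hmn θ hθ) ht0.le).trans_lt htδ
  have hclose : ∀ θ ∈ Icc (0 : ℝ) 1, ∀ p ∈ K, ∀ q : E, q = p - s → ‖q‖ = ρ →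
      ρ ^ 2 + inner ℝ u v ≤ 2 * inner ℝ (m θ) q → infDist (x θ) K < ρ := by
    intro θ hθ p hp q hq hqn hin
    refine (infDist_le_dist_of_mem hp).trans_lt ?_
    rw [dist_eq_norm]
    have e1 : x θ - p = t • m θ - q := by simp only [hx, hq]; abel
    rw [e1]
    refine lt_of_pow_lt_pow_left₀ 2 hs.le ?_
    rw [norm_sub_sq_real, norm_smul, inner_smul_left, hqn, Real.norm_eq_abs, abs_of_pos ht0,
      mul_pow]
    simp only [conj_trivial]
    have h1 : ‖m θ‖ ^ 2 ≤ ρ ^ 2 := pow_le_pow_left₀ (norm_nonneg _) (hmn θ hθ) 2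
    have h2 : t ^ 2 * ‖m θ‖ ^ 2 ≤ t ^ 2 * ρ ^ 2 := mul_le_mul_of_nonneg_left h1 (sq_nonneg t)
    nlinarith [mul_le_mul_of_nonneg_left hin ht0.le, mul_lt_mul_of_pos_left htc ht0]
  have hlt : ∀ θ ∈ Icc (0 : ℝ) 1, infDist (x θ) K < ρ := by
    intro θ hθ
    have hsum : inner ℝ (m θ) u + inner ℝ (m θ) v = ρ ^ 2 + inner ℝ u v := by
      simp only [hm, inner_add_left, inner_smul_left, real_inner_self_eq_norm_sq, hun, hvn,
        conj_trivial, real_inner_comm u v]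
      ring
    rcases le_total (inner ℝ (m θ) u) (inner ℝ (m θ) v) with h | h
    · exact hclose θ hθ z hz v rfl hvn (by linarith)
    · exact hclose θ hθ y hy u rfl hun (by linarith)
  have hend : ∀ p ∈ K, dist s p = ρ → dist (s + t • (p - s)) p = infDist (s + t • (p - s)) K := by
    intro p hp hsp
    refine le_antisymm ?_ (infDist_le_dist_of_mem hp)
    have h1 : infDist s K ≤ infDist (s + t • (p - s)) K + dist s (s + t • (p - s)) :=
      infDist_le_infDist_add_dist
    have h2 : dist s (s + t • (p - s)) = t * ρ := by
      rw [dist_self_add_right, norm_smul, ← dist_eq_norm, dist_comm p, hsp, Real.norm_eq_abs,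
        abs_of_pos ht0]
    have h3 : dist (s + t • (p - s)) p = (1 - t) * ρ := by
      have e1 : s + t • (p - s) - p = (1 - t) • (s - p) := by module
      rw [dist_eq_norm, e1, norm_smul, ← dist_eq_norm s p, hsp, Real.norm_eq_abs,
        abs_of_pos (by linarith)]
    rw [h3]; linarith
  have hcl : ∀ F : Set E, IsClosed F →
      IsClosed {θ | θ ∈ Icc (0 : ℝ) 1 ∧ ∃ a ∈ K, a ∈ F ∧ dist (x θ) a = infDist (x θ) K} := by
    intro F hF
    have hc : IsCompact ((Icc (0 : ℝ) 1 ×ˢ K) ∩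
        {p : ℝ × E | p.2 ∈ F ∧ dist (x p.1) p.2 = infDist (x p.1) K}) := by
      refine (isCompact_Icc.prod hK).inter_right ?_
      refine (hF.preimage continuous_snd).inter (isClosed_eq ?_ ?_)
      · exact (hxc.comp continuous_fst).dist continuous_snd
      · exact (continuous_infDist_pt K).comp (hxc.comp continuous_fst)
    convert (hc.image continuous_fst).isClosed using 1
    ext θ
    constructor
    · rintro ⟨hθ, a, ha, haF, had⟩
      exact ⟨(θ, a), ⟨⟨hθ, ha⟩, haF, had⟩, rfl⟩
    · rintro ⟨⟨θ', a⟩, ⟨⟨hθ, ha⟩, haF, had⟩, rfl⟩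
      exact ⟨hθ, a, ha, haF, had⟩
  obtain ⟨θ, hθ, ⟨-, a, ha, haF, had⟩, ⟨-, b, hb, hbF, hbd⟩⟩ :=
    isPreconnected_closed_iff.1 (isPreconnected_Icc (a := (0 : ℝ)) (b := 1))
      _ _ (hcl (closedBall y (ε / 3)) isClosed_closedBall)
      (hcl (ball y (ε / 2))ᶜ isOpen_ball.isClosed_compl)
      (by
        intro θ hθ
        obtain ⟨a, ha, had⟩ := hK.exists_infDist_eq_dist ⟨y, hy⟩ (x θ)
        rcases (hball (hxs θ hθ)).1 a ha had.symm with h | h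
        · exact Or.inl ⟨hθ, a, ha, ball_subset_closedBall h, had.symm⟩
        · exact Or.inr ⟨hθ, a, ha, fun h' => h (ball_subset_closedBall h'), had.symm⟩)
      ⟨0, by simp, by simp, y, hy, mem_closedBall_self (by positivity), by
        simpa [hx, hm] using hend y hy hsy⟩
      ⟨1, by simp, by simp, z, hz, (by
        intro h
        exact hzy (hiso ((mem_ball.1 h).trans (by linarith)) hz hsz)), by
        simpa [hx, hm] using hend z hz hsz⟩
  have hab : a = b := (hball (hxs θ hθ)).2 (hlt θ hθ) a ha b hb had hbd
  subst hab
  rw [mem_closedBall] at haF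
  rw [mem_compl_iff, mem_ball, not_lt] at hbF
  linarith

end ClosestPoints

section Ridge

open Filter Topology

/-- The geometry of an open set `Ω` with boundary `K` whose cut locus `S` lies at constant
distance `ρ` from every boundary point. -/
structure IsEquidistantRidge (Ω K S : Set E2) (ρ : ℝ) : Prop where
  pos : 0 < ρ
  isCompact : IsCompact K
  disjoint : Disjoint Ω K
  ball_subset : ∀ s ∈ S, ball s ρ ⊆ Ω
  exists_dist_eq : ∀ y ∈ K, ∃ s ∈ S, dist s y = ρ
  dense_multiple : ∀ s ∈ S, ∃ᶠ s' in 𝓝 s,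
    s' ∈ S ∧ ∃ y ∈ K, ∃ z ∈ K, dist s' y = ρ ∧ dist s' z = ρ ∧ y ≠ z
  eq_midpoint : ∀ s ∈ S, ∀ y ∈ K, ∀ z ∈ K, dist s y = ρ → dist s z = ρ → z ≠ y →
    (∀ᶠ y' in 𝓝 y, y' ∈ K → dist s y' = ρ → y' = y) → s = midpoint ℝ y z

theorem IsEquidistantRidge.le_dist {Ω K S : Set E2} {ρ : ℝ} (h : IsEquidistantRidge Ω K S ρ)
    {s y : E2} (hs : s ∈ S) (hy : y ∈ K) : ρ ≤ dist s y := by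
  by_contra hlt
  exact h.disjoint.le_bot ⟨h.ball_subset s hs (by rw [mem_ball, dist_comm]; linarith), hy⟩

theorem IsEquidistantRidge.exists_mem_dist_eq {Ω K S : Set E2} {ρ : ℝ}
    (h : IsEquidistantRidge Ω K S ρ) {s : E2} (hs : s ∈ S) : ∃ y ∈ K, dist s y = ρ := by
  by_contra! hn
  have h1 := eventually_closest_mem h.isCompact (continuous_const (y := ρ)) isOpen_empty (s := s)
    fun y hy hd => hn y hy hd
  obtain ⟨s', ⟨-, y, hy, -, -, hd, -⟩, hs'⟩ := ((h.dense_multiple s hs).and_eventually h1).exists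
  exact hs' y hy hd

theorem IsPreconnected.subset_of_disjoint_frontier {X : Type*} [TopologicalSpace X]
    {t u : Set X} (ht : IsPreconnected t) (hu : IsOpen u) (hd : Disjoint t (frontier u))
    (hne : (t ∩ u).Nonempty) : t ⊆ u := by
  refine ht.subset_left_of_subset_union hu isClosed_closure.isOpen_compl
    (disjoint_compl_right.mono_left subset_closure) (fun x hx => ?_) hne
  by_contra hn
  rw [mem_union, not_or, mem_compl_iff, not_not] at hn
  exact hd.le_bot ⟨hx, hn.2, fun h => hn.1 (interior_subset h)⟩

variable {Ω : Set E2}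

theorem frontier_nonempty_of_isBounded (hne : Ω.Nonempty) (hbd : Bornology.IsBounded Ω) :
    (frontier Ω).Nonempty := by
  rw [nonempty_frontier_iff]
  refine ⟨hne, fun h => ?_⟩
  rw [h] at hbd
  exact NormedSpace.unbounded_univ ℝ E2 hbd

theorem isCompact_frontier_of_isBounded (hbd : Bornology.IsBounded Ω) :
    IsCompact (frontier Ω) :=
  hbd.isCompact_closure.of_isClosed_subset isClosed_frontier frontier_subset_closure

theorem infDist_frontier_le_inradius (hbd : Bornology.IsBounded Ω) {x : E2}
    (hx : x ∈ closure Ω) : infDist x (frontier Ω) ≤ inradius Ω :=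
  le_csSup (hbd.isCompact_closure.image (continuous_infDist_pt _)).bddAbove ⟨x, hx, rfl⟩

theorem mem_highRidge_iff (hbd : Bornology.IsBounded Ω) {x : E2} (hx : x ∈ closure Ω) :
    x ∈ highRidge Ω ↔ infDist x (frontier Ω) = inradius Ω := by
  constructor
  · intro h
    refine le_antisymm (infDist_frontier_le_inradius hbd hx) (csSup_le ⟨_, x, hx, rfl⟩ ?_)
    rintro _ ⟨z, hz, rfl⟩
    exact h.2 z hz
  · exact fun h => ⟨hx, fun z hz => h ▸ infDist_frontier_le_inradius hbd hz⟩

theorem infDist_frontier_pos (hne : Ω.Nonempty) (hop : IsOpen Ω) (hbd : Bornology.IsBounded Ω)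
    {x : E2} (hx : x ∈ Ω) : 0 < infDist x (frontier Ω) :=
  (isClosed_frontier.notMem_iff_infDist_pos (frontier_nonempty_of_isBounded hne hbd)).1
    fun h => h.2 (hop.interior_eq.symm ▸ hx)

theorem mem_of_infDist_frontier_pos {x : E2} (hx : x ∈ closure Ω)
    (h : 0 < infDist x (frontier Ω)) : x ∈ Ω := by
  by_contra hn
  have : x ∈ frontier Ω := ⟨hx, fun h' => hn (interior_subset h')⟩
  rw [infDist_zero_of_mem this] at h
  exact h.false

theorem inradius_pos (hne : Ω.Nonempty) (hop : IsOpen Ω) (hbd : Bornology.IsBounded Ω) :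
    0 < inradius Ω :=
  let ⟨_, hx⟩ := hne
  (infDist_frontier_pos hne hop hbd hx).trans_le
    (infDist_frontier_le_inradius hbd (subset_closure hx))

theorem highRidge_subset (hne : Ω.Nonempty) (hop : IsOpen Ω) (hbd : Bornology.IsBounded Ω) :
    highRidge Ω ⊆ Ω := fun x hx =>
  mem_of_infDist_frontier_pos hx.1 (by
    rw [(mem_highRidge_iff hbd hx.1).1 hx]; exact inradius_pos hne hop hbd)

theorem isCompact_highRidge (hbd : Bornology.IsBounded Ω) : IsCompact (highRidge Ω) := by
  have : highRidge Ω = closure Ω ∩ {x | infDist x (frontier Ω) = inradius Ω} := by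
    ext x
    exact ⟨fun h => ⟨h.1, (mem_highRidge_iff hbd h.1).1 h⟩,
      fun h => (mem_highRidge_iff hbd h.1).2 h.2⟩
  rw [this]
  exact hbd.isCompact_closure.inter_right
    (isClosed_eq (continuous_infDist_pt _) continuous_const)

theorem closest_unique_of_notMem_highRidge (hcut : highRidge Ω = cutLocus Ω) {x a b : E2}
    (hx : x ∈ Ω) (hxS : x ∉ highRidge Ω) (ha : a ∈ projBd Ω x) (hb : b ∈ projBd Ω x) :
    a = b := by
  by_contra hab
  exact hxS (hcut ▸ subset_closure ⟨hx, a, ha, b, hb, hab⟩)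

/-- When the high ridge is the cut locus, every point of the domain can be joined to the high
ridge by a path along which the boundary distance grows at almost unit speed. -/
theorem exists_highRidge_mul_dist_le (hne : Ω.Nonempty) (hop : IsOpen Ω)
    (hbd : Bornology.IsBounded Ω) (hcut : highRidge Ω = cutLocus Ω) {x : E2} (hx : x ∈ Ω)
    {c : ℝ} (hc0 : 0 < c) (hc1 : c < 1) :
    ∃ s ∈ highRidge Ω, c * dist s x ≤ inradius Ω - infDist x (frontier Ω) := by
  set d := fun z => infDist z (frontier Ω) with hd
  have hdc : Continuous d := continuous_infDist_pt _
  have hA : IsCompact (closure Ω ∩ {w | d x + c * dist w x ≤ d w}) :=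
    hbd.isCompact_closure.inter_right (isClosed_le (by fun_prop) hdc)
  obtain ⟨w, ⟨hwΩ, hw⟩, hmax⟩ :=
    hA.exists_isMaxOn ⟨x, subset_closure hx, by simp⟩ hdc.continuousOn
  have hw : d x + c * dist w x ≤ d w := hw
  have hdx : 0 < d x := infDist_frontier_pos hne hop hbd hx
  have hdw : 0 < d w := by
    have : 0 ≤ c * dist w x := by positivity
    linarith
  have hwΩ' : w ∈ Ω := mem_of_infDist_frontier_pos hwΩ hdw
  have hwS : w ∈ highRidge Ω := by
    by_contra hwS
    obtain ⟨y, hy, hwy⟩ := (isCompact_frontier_of_isBounded hbd).exists_infDist_eq_dist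
      (frontier_nonempty_of_isBounded hne hbd) w
    have h1 := eventually_infDist_ascent (isCompact_frontier_of_isBounded hbd) hy hwy.symm hdw
      (fun z hz hwz => closest_unique_of_notMem_highRidge hcut hwΩ' hwS ⟨hz, hwz⟩ ⟨hy, hwy.symm⟩)
      hc0 hc1
    have h2 : ∀ᶠ h in 𝓝[>] (0 : ℝ), w + h • (w - y) ∈ Ω := by
      have hcont : Continuous (fun h : ℝ => w + h • (w - y)) := by fun_prop
      have h3 := (hop.preimage hcont).mem_nhds (x := 0) (by simpa using hwΩ')
      exact nhdsWithin_le_nhds h3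
    obtain ⟨h, ⟨hh1, hh2⟩, hh0⟩ := ((h1.and h2).and self_mem_nhdsWithin).exists
    have hh0 : 0 < h := hh0
    have hdist : dist (w + h • (w - y)) x ≤ h * d w + dist w x := by
      refine (dist_triangle _ w _).trans ?_
      rw [dist_self_add_left, norm_smul, ← dist_eq_norm w y, ← hwy, Real.norm_eq_abs,
        abs_of_pos hh0]
    have hh1 : d w + c * (h * d w) ≤ d (w + h • (w - y)) := hh1
    have hmem : w + h • (w - y) ∈ closure Ω ∩ {w | d x + c * dist w x ≤ d w} := by
      refine ⟨subset_closure hh2, ?_⟩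
      show d x + c * dist (w + h • (w - y)) x ≤ d (w + h • (w - y))
      nlinarith [mul_le_mul_of_nonneg_left hdist hc0.le]
    have h4 : d (w + h • (w - y)) ≤ d w := hmax hmem
    have : 0 < c * (h * d w) := by positivity
    linarith
  refine ⟨w, hwS, ?_⟩
  have := (mem_highRidge_iff hbd hwΩ).1 hwS
  have h5 : d w = inradius Ω := this
  have h6 : d x = infDist x (frontier Ω) := rfl
  linarith

theorem highRidge_nonempty (hne : Ω.Nonempty) (hbd : Bornology.IsBounded Ω) :
    (highRidge Ω).Nonempty := by
  obtain ⟨x, hx, hmax⟩ := hbd.isCompact_closure.exists_isMaxOn hne.closure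
    (continuous_infDist_pt (frontier Ω)).continuousOn
  exact ⟨x, hx, fun z hz => hmax hz⟩

theorem infDist_highRidge_le (hne : Ω.Nonempty) (hop : IsOpen Ω)
    (hbd : Bornology.IsBounded Ω) (hcut : highRidge Ω = cutLocus Ω) {x : E2} (hx : x ∈ Ω) :
    infDist x (highRidge Ω) ≤ inradius Ω - infDist x (frontier Ω) := by
  have h : ∀ᶠ c in 𝓝[<] (1 : ℝ),
      c * infDist x (highRidge Ω) ≤ inradius Ω - infDist x (frontier Ω) := by
    filter_upwards [Ioo_mem_nhdsLT (zero_lt_one' ℝ)] with c hc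
    obtain ⟨s, hs, hsx⟩ := exists_highRidge_mul_dist_le hne hop hbd hcut hx hc.1 hc.2
    refine le_trans (mul_le_mul_of_nonneg_left ?_ hc.1.le) hsx
    rw [dist_comm]
    exact infDist_le_dist_of_mem hs
  have ht : Tendsto (fun c : ℝ => c * infDist x (highRidge Ω)) (𝓝[<] 1)
      (𝓝 (1 * infDist x (highRidge Ω))) :=
    (tendsto_id.mul_const _).mono_left nhdsWithin_le_nhds
  rw [one_mul] at ht
  exact le_of_tendsto ht h

theorem ball_subset_of_mem_highRidge (hne : Ω.Nonempty) (hop : IsOpen Ω)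
    (hbd : Bornology.IsBounded Ω) {s : E2} (hs : s ∈ highRidge Ω) :
    ball s (inradius Ω) ⊆ Ω := by
  have hd : Disjoint (ball s (inradius Ω)) (frontier Ω) := by
    rw [← (mem_highRidge_iff hbd hs.1).1 hs]
    exact disjoint_ball_infDist
  exact (convex_ball s (inradius Ω)).isPreconnected.subset_of_disjoint_frontier hop hd
    ⟨s, mem_ball_self (inradius_pos hne hop hbd), highRidge_subset hne hop hbd hs⟩

theorem eq_setOf_infDist_highRidge_lt (hne : Ω.Nonempty) (hop : IsOpen Ω)
    (hbd : Bornology.IsBounded Ω) (hcut : highRidge Ω = cutLocus Ω) :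
    Ω = {x | infDist x (highRidge Ω) < inradius Ω} := by
  ext x
  constructor
  · intro hx
    have h1 := infDist_highRidge_le hne hop hbd hcut hx
    have h2 := infDist_frontier_pos hne hop hbd hx
    show infDist x (highRidge Ω) < inradius Ω
    linarith
  · intro hx
    obtain ⟨s, hs, hxs⟩ := (infDist_lt_iff (highRidge_nonempty hne hbd)).1 hx
    exact ball_subset_of_mem_highRidge hne hop hbd hs hxs

theorem isEquidistantRidge_highRidge (hne : Ω.Nonempty) (hop : IsOpen Ω)
    (hbd : Bornology.IsBounded Ω) (hcut : highRidge Ω = cutLocus Ω) :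
    IsEquidistantRidge Ω (frontier Ω) (highRidge Ω) (inradius Ω) where
  pos := inradius_pos hne hop hbd
  isCompact := isCompact_frontier_of_isBounded hbd
  disjoint := Set.disjoint_iff_inter_eq_empty.2 hop.inter_frontier_eq
  ball_subset s hs := ball_subset_of_mem_highRidge hne hop hbd hs
  exists_dist_eq y hy := by
    have h1 : infDist y (highRidge Ω) ≤ inradius Ω := by
      have hcl : IsClosed {x | infDist x (highRidge Ω) ≤ inradius Ω} :=
        isClosed_le (continuous_infDist_pt _) continuous_const
      refine hcl.closure_subset_iff.2 (fun x hx => ?_) (frontier_subset_closure hy)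
      exact (infDist_highRidge_le hne hop hbd hcut hx).trans (sub_le_self _ infDist_nonneg)
    obtain ⟨s, hs, hsy⟩ := (isCompact_highRidge hbd).exists_infDist_eq_dist
      (highRidge_nonempty hne hbd) y
    refine ⟨s, hs, le_antisymm ?_ ?_⟩
    · rw [dist_comm, ← hsy]; exact h1
    · rw [← (mem_highRidge_iff hbd hs.1).1 hs]; exact infDist_le_dist_of_mem hy
  dense_multiple s hs := by
    have h1 : s ∈ closure (skeleton Ω) := by rw [hcut] at hs; exact hs
    refine (mem_closure_iff_frequently.1 h1).mono fun s' hs' => ?_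
    have h2 : s' ∈ highRidge Ω := by rw [hcut]; exact subset_closure hs'
    have h3 := (mem_highRidge_iff hbd h2.1).1 h2
    obtain ⟨-, y, hy, z, hz, hyz⟩ := hs'
    exact ⟨h2, y, hy.1, z, hz.1, h3 ▸ hy.2, h3 ▸ hz.2, hyz⟩
  eq_midpoint s hs y hy z hz hsy hsz hzy hiso := by
    have h1 := (mem_highRidge_iff hbd hs.1).1 hs
    rw [← h1] at hsy hsz hiso
    refine eq_midpoint_of_isolated_closest (isCompact_frontier_of_isBounded hbd)
      (h1 ▸ inradius_pos hne hop hbd) hy hz hsy hsz hzy hiso ?_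
    filter_upwards [hop.mem_nhds (highRidge_subset hne hop hbd hs)] with x hx hlt a ha b hb hxa hxb
    refine closest_unique_of_notMem_highRidge hcut hx (fun hxS => ?_) ⟨ha, hxa⟩ ⟨hb, hxb⟩
    rw [(mem_highRidge_iff hbd hxS.1).1 hxS, h1] at hlt
    exact hlt.false

end Ridge

section ParallelCurve

open Filter Topology

/-- First coordinate of the point at height `ρ` on the upward normal to the graph of `g`. -/
def normalX (ρ : ℝ) (g : ℝ → ℝ) (t : ℝ) : ℝ := t - ρ * deriv g t / √(1 + deriv g t ^ 2)

/-- Second coordinate of the point at height `ρ` on the upward normal to the graph of `g`. -/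
def normalY (ρ : ℝ) (g : ℝ → ℝ) (t : ℝ) : ℝ := g t + ρ / √(1 + deriv g t ^ 2)

theorem sqrt_one_add_sq_pos (a : ℝ) : 0 < √(1 + a ^ 2) := Real.sqrt_pos.2 (by positivity)

theorem contDiff_deriv_of_two {g : ℝ → ℝ} (hg : ContDiff ℝ 2 g) : ContDiff ℝ 1 (deriv g) :=
  (contDiff_succ_iff_deriv.1 (show ContDiff ℝ (1 + 1) g from by norm_num; exact hg)).2.2

theorem contDiff_normalX (ρ : ℝ) {g : ℝ → ℝ} (hg : ContDiff ℝ 2 g) :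
    ContDiff ℝ 1 (normalX ρ g) := by
  have h := contDiff_deriv_of_two hg
  exact contDiff_id.sub ((contDiff_const.mul h).div
    ((contDiff_const.add (h.pow 2)).sqrt fun t => by positivity)
    fun t => (sqrt_one_add_sq_pos _).ne')

theorem hasDerivAt_normalX_and_normalY {g : ℝ → ℝ} (hg : ContDiff ℝ 2 g) (ρ t : ℝ) :
    HasDerivAt (normalX ρ g) (1 - ρ * deriv (deriv g) t / √(1 + deriv g t ^ 2) ^ 3) t ∧
    HasDerivAt (normalY ρ g)
      (deriv g t * (1 - ρ * deriv (deriv g) t / √(1 + deriv g t ^ 2) ^ 3)) t := by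
  have hp : HasDerivAt (deriv g) (deriv (deriv g) t) t :=
    ((contDiff_deriv_of_two hg).differentiable (by norm_num) t).hasDerivAt
  have hg' : HasDerivAt g (deriv g t) t := (hg.differentiable (by norm_num) t).hasDerivAt
  have hw := sqrt_one_add_sq_pos (deriv g t)
  have hw2 : √(1 + deriv g t ^ 2) ^ 2 = 1 + deriv g t ^ 2 := Real.sq_sqrt (by positivity)
  have hs := ((hp.fun_pow 2).const_add 1).sqrt (by positivity)
  constructor
  · refine ((hasDerivAt_id t).sub ((hp.const_mul ρ).div hs hw.ne')).congr_deriv ?_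
    generalize √(1 + deriv g t ^ 2) = w at hw hw2
    generalize deriv g t = p at hw hw2
    field_simp
    norm_num
    linear_combination (-2) * ρ * (deriv (deriv g) t) * hw2
  · refine (hg'.add ((hasDerivAt_const t ρ).div hs hw.ne')).congr_deriv ?_
    generalize √(1 + deriv g t ^ 2) = w at hw hw2
    generalize deriv g t = p at hw hw2
    field_simp
    norm_num
    ring

theorem hasDerivAt_normalX {g : ℝ → ℝ} (hg : ContDiff ℝ 2 g) (ρ t : ℝ) :
    HasDerivAt (normalX ρ g) (deriv (normalX ρ g) t) t :=
  (hasDerivAt_normalX_and_normalY hg ρ t).1.differentiableAt.hasDerivAt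

theorem hasDerivAt_normalY {g : ℝ → ℝ} (hg : ContDiff ℝ 2 g) (ρ t : ℝ) :
    HasDerivAt (normalY ρ g) (deriv g t * deriv (normalX ρ g) t) t := by
  rw [(hasDerivAt_normalX_and_normalY hg ρ t).1.deriv]
  exact (hasDerivAt_normalX_and_normalY hg ρ t).2

/-- The velocities of two planar curves that move monotonically with respect to each other have
nonnegative inner product. -/
theorem add_mul_deriv_nonneg {a b c d : ℝ → ℝ} {a' b' c' d' t : ℝ}
    (ha : HasDerivAt a a' t) (hb : HasDerivAt b b' t) (hc : HasDerivAt c c' t)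
    (hd : HasDerivAt d d' t)
    (h : ∀ᶠ x in 𝓝 t, 0 ≤ (a x - a t) * (b x - b t) + (c x - c t) * (d x - d t)) :
    0 ≤ a' * b' + c' * d' := by
  rw [hasDerivAt_iff_tendsto_slope] at ha hb hc hd
  refine ge_of_tendsto ((ha.mul hb).add (hc.mul hd)) ?_
  filter_upwards [nhdsWithin_le_nhds h] with x hx
  simp only [slope_def_field]
  have : (a x - a t) / (x - t) * ((b x - b t) / (x - t)) +
      (c x - c t) / (x - t) * ((d x - d t) / (x - t)) =
      ((a x - a t) * (b x - b t) + (c x - c t) * (d x - d t)) / (x - t) ^ 2 := by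
    rw [div_mul_div_comm, div_mul_div_comm, ← add_div, sq]
  rw [this]
  positivity

theorem exists_contDiffAt_local_inverse {f : ℝ → ℝ} (hf : ContDiff ℝ 1 f) {a : ℝ}
    (ha : deriv f a ≠ 0) :
    ∃ ψ : ℝ → ℝ, ContDiffAt ℝ 1 ψ (f a) ∧ (∀ᶠ x in 𝓝 a, ψ (f x) = x) ∧
      ∀ᶠ y in 𝓝 (f a), f (ψ y) = y := by
  have hs : HasStrictDerivAt f (deriv f a) a := hf.contDiffAt.hasStrictDerivAt (by norm_num)
  have he := hs.hasStrictFDerivAt_equiv ha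
  exact ⟨_, hf.contDiffAt.to_localInverse he.hasFDerivAt one_ne_zero,
    he.eventually_left_inverse, he.eventually_right_inverse⟩

theorem ContDiffAt.exists_contDiff_eventuallyEq {f : ℝ → ℝ} {a : ℝ} (hf : ContDiffAt ℝ 2 f a) :
    ∃ F : ℝ → ℝ, ContDiff ℝ 2 F ∧ F =ᶠ[𝓝 a] f := by
  obtain ⟨r, hr, hball⟩ := Metric.eventually_nhds_iff.1 (hf.eventually (by simp))
  let χ : ContDiffBump a := ⟨r / 4, r / 2, by positivity, by linarith⟩
  refine ⟨fun x => χ x * f x, contDiff_iff_contDiffAt.2 fun x => ?_, ?_⟩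
  · by_cases hx : x ∈ tsupport χ
    · rw [χ.tsupport_eq] at hx
      refine ContDiffAt.mul ?_ (hball (lt_of_le_of_lt (mem_closedBall.1 hx) ?_))
      · exact (χ.contDiff (n := 2)).contDiffAt
      · show r / 2 < r
        linarith
    · refine (contDiffAt_const (c := (0 : ℝ))).congr_of_eventuallyEq ?_
      filter_upwards [notMem_tsupport_iff_eventuallyEq.1 hx] with z hz
      rw [hz]; simp
  · filter_upwards [χ.eventuallyEq_one] with x hx
    rw [hx]; simp

/-- The parallel curve of a `C²` graph is again a `C²` graph where it is regular. -/
theorem contDiffAt_normalY_comp {g ψ : ℝ → ℝ} (hg : ContDiff ℝ 2 g) {ρ x₀ : ℝ}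
    (hψ : ContDiffAt ℝ 1 ψ x₀) (hinv : ∀ᶠ v in 𝓝 x₀, normalX ρ g (ψ v) = v) :
    ContDiffAt ℝ 2 (normalY ρ g ∘ ψ) x₀ := by
  have hderiv : ∀ᶠ v in 𝓝 x₀, HasDerivAt (normalY ρ g ∘ ψ) (deriv g (ψ v)) v := by
    filter_upwards [hinv.eventually_nhds, hψ.eventually (by simp)] with v hv hψv
    have h1 : HasDerivAt ψ (deriv ψ v) v := (hψv.differentiableAt one_ne_zero).hasDerivAt
    have h2 := ((hasDerivAt_normalX hg ρ (ψ v)).comp v h1).congr_of_eventuallyEq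
      (EventuallyEq.symm hv : (fun v => v) =ᶠ[𝓝 v] normalX ρ g ∘ ψ)
    have h3 := h2.unique (hasDerivAt_id v)
    refine ((hasDerivAt_normalY hg ρ (ψ v)).comp v h1).congr_deriv ?_
    rw [mul_assoc, h3, mul_one]
  have h4 : ContDiffAt ℝ 1 (fun v => deriv g (ψ v)) x₀ :=
    (contDiff_deriv_of_two hg).contDiffAt.comp x₀ hψ
  have h5 : ContDiffAt ℝ ((1 : ℕ) + 1) (normalY ρ g ∘ ψ) x₀ := by
    rw [contDiffAt_succ_iff_hasFDerivAt]
    refine ⟨fun v => ContinuousLinearMap.toSpanSingleton ℝ (deriv g (ψ v)),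
      ⟨_, hderiv, fun v hv => hasDerivAt_iff_hasFDerivAt.1 hv⟩, ?_⟩
    exact (ContinuousLinearMap.toSpanSingletonCLE (𝕜 := ℝ) (E := ℝ)).contDiff.contDiffAt.comp x₀ h4
  norm_num at h5
  exact h5

end ParallelCurve

section Chart

open Filter Topology

theorem E2.ext_coords {z w : E2} (h0 : z 0 = w 0) (h1 : z 1 = w 1) : z = w := by
  ext i; fin_cases i
  · exact h0
  · exact h1

theorem continuous_coord (e : E2 ≃ᵃⁱ[ℝ] E2) (i : Fin 2) : Continuous fun z => e z i := by
  have := e.continuous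
  fun_prop

theorem dist_sq_coords (e : E2 ≃ᵃⁱ[ℝ] E2) (z w : E2) :
    dist z w ^ 2 = (e z 0 - e w 0) ^ 2 + (e z 1 - e w 1) ^ 2 := by
  rw [← e.dist_map, EuclideanSpace.dist_eq, Real.sq_sqrt (by positivity), Fin.sum_univ_two,
    Real.dist_eq, Real.dist_eq, sq_abs, sq_abs]

theorem continuous_symm_pt (e : E2 ≃ᵃⁱ[ℝ] E2) {a b : ℝ → ℝ} (ha : Continuous a)
    (hb : Continuous b) : Continuous fun t => e.symm (pt (a t) (b t)) := by
  refine e.symm.continuous.comp ?_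
  refine (EuclideanSpace.equiv (Fin 2) ℝ).symm.continuous.comp (continuous_pi fun i => ?_)
  fin_cases i
  · exact ha
  · exact hb

/-- In the coordinates `e`, inside the open set `U`, the set `Ω` is the region above the graph of
the `C²` function `g` and `K` is the graph. -/
structure IsGraphChart (Ω K : Set E2) (e : E2 ≃ᵃⁱ[ℝ] E2) (U : Set E2) (g : ℝ → ℝ) : Prop where
  isOpen : IsOpen U
  contDiff : ContDiff ℝ 2 g
  mem_domain_iff : ∀ z ∈ U, z ∈ Ω ↔ g (e z 0) < e z 1
  mem_bd_iff : ∀ z ∈ U, z ∈ K ↔ g (e z 0) = e z 1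

/-- The graph of `g` in the coordinates `e`. -/
def graphCurve (e : E2 ≃ᵃⁱ[ℝ] E2) (g : ℝ → ℝ) (t : ℝ) : E2 := e.symm (pt t (g t))

theorem coord_symm_pt_zero (e : E2 ≃ᵃⁱ[ℝ] E2) (a b : ℝ) : e (e.symm (pt a b)) 0 = a := by
  rw [e.apply_symm_apply]; rfl

theorem coord_symm_pt_one (e : E2 ≃ᵃⁱ[ℝ] E2) (a b : ℝ) : e (e.symm (pt a b)) 1 = b := by
  rw [e.apply_symm_apply]; rfl

namespace IsGraphChart

variable {Ω K S U : Set E2} {ρ : ℝ} {e : E2 ≃ᵃⁱ[ℝ] E2} {g : ℝ → ℝ}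

theorem continuous_graphCurve (c : IsGraphChart Ω K e U g) : Continuous (graphCurve e g) :=
  continuous_symm_pt e continuous_id c.contDiff.continuous

theorem graphCurve_mem (c : IsGraphChart Ω K e U g) {t : ℝ} (ht : graphCurve e g t ∈ U) :
    graphCurve e g t ∈ K := by
  rw [c.mem_bd_iff _ ht, graphCurve, coord_symm_pt_zero, coord_symm_pt_one]

theorem eq_graphCurve (c : IsGraphChart Ω K e U g) {y : E2} (hy : y ∈ K) (hyU : y ∈ U) :
    y = graphCurve e g (e y 0) := by
  apply e.injective
  rw [graphCurve, e.apply_symm_apply]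
  exact E2.ext_coords rfl ((c.mem_bd_iff y hyU).1 hy).symm

theorem eventually_graphCurve_mem (c : IsGraphChart Ω K e U g) {t : ℝ}
    (ht : graphCurve e g t ∈ U) : ∀ᶠ x in 𝓝 t, graphCurve e g x ∈ U :=
  (c.isOpen.preimage c.continuous_graphCurve).mem_nhds ht

theorem coords_of_dist_eq (c : IsGraphChart Ω K e U g) (h : IsEquidistantRidge Ω K S ρ) {t : ℝ}
    (ht : graphCurve e g t ∈ U) {s : E2} (hs : s ∈ S) (hd : dist s (graphCurve e g t) = ρ) :
    e s 0 = normalX ρ g t ∧ e s 1 = normalY ρ g t := by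
  have hρ := h.pos
  set p := deriv g t with hp
  set w := √(1 + p ^ 2) with hw
  have hw0 : 0 < w := sqrt_one_add_sq_pos p
  have hw2 : w ^ 2 = 1 + p ^ 2 := Real.sq_sqrt (by positivity)
  have hg : HasDerivAt g p t := (c.contDiff.differentiable (by norm_num) t).hasDerivAt
  have hd2 : (e s 0 - t) ^ 2 + (e s 1 - g t) ^ 2 = ρ ^ 2 := by
    rw [← hd, dist_sq_coords e, graphCurve, coord_symm_pt_zero, coord_symm_pt_one]
  have hcrit : (e s 0 - t) + (e s 1 - g t) * p = 0 := by
    have hf : HasDerivAt (fun x => (e s 0 - x) ^ 2 + (e s 1 - g x) ^ 2)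
        (-2 * ((e s 0 - t) + (e s 1 - g t) * p)) t := by
      refine ((((hasDerivAt_id t).const_sub (e s 0)).pow 2).add
        ((hg.const_sub (e s 1)).pow 2)).congr_deriv ?_
      simp only [id]
      push_cast
      ring
    have hmin : IsLocalMin (fun x => (e s 0 - x) ^ 2 + (e s 1 - g x) ^ 2) t := by
      filter_upwards [c.eventually_graphCurve_mem ht] with x hx
      rw [hd2]
      have h1 := h.le_dist hs (c.graphCurve_mem hx)
      have h2 := pow_le_pow_left₀ hρ.le h1 2
      rwa [dist_sq_coords e, graphCurve, coord_symm_pt_zero, coord_symm_pt_one] at h2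
    have := hmin.hasDerivAt_eq_zero hf
    linarith
  have hsign : 0 ≤ e s 1 - g t := by
    set q : ℝ → E2 := fun r => e.symm (pt (t + r * (e s 0 - t)) (g t + r * (e s 1 - g t))) with hq
    have hq0 : q 0 = graphCurve e g t := by simp [hq, graphCurve]
    have hqc : Continuous q := continuous_symm_pt e (by fun_prop) (by fun_prop)
    have hφ : HasDerivAt (fun r => g t + r * (e s 1 - g t) - g (t + r * (e s 0 - t)))
        ((e s 1 - g t) - p * (e s 0 - t)) 0 := by
      have h1 : HasDerivAt (fun r : ℝ => t + r * (e s 0 - t)) (e s 0 - t) 0 := by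
        simpa using ((hasDerivAt_id (0 : ℝ)).mul_const (e s 0 - t)).const_add t
      have h2 : HasDerivAt (fun r : ℝ => g t + r * (e s 1 - g t)) (e s 1 - g t) 0 := by
        simpa using ((hasDerivAt_id (0 : ℝ)).mul_const (e s 1 - g t)).const_add (g t)
      have h3 : HasDerivAt g p (t + 0 * (e s 0 - t)) := by simpa using hg
      exact h2.sub (h3.comp (0 : ℝ) h1)
    have hpos : ∀ᶠ r in 𝓝[>] (0 : ℝ),
        0 ≤ slope (fun r => g t + r * (e s 1 - g t) - g (t + r * (e s 0 - t))) 0 r := by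
      have hqU : ∀ᶠ r in 𝓝[>] (0 : ℝ), q r ∈ U :=
        nhdsWithin_le_nhds ((c.isOpen.preimage hqc).mem_nhds
          (show q 0 ∈ U by rw [hq0]; exact ht))
      filter_upwards [hqU, Ioo_mem_nhdsGT (zero_lt_one' ℝ)] with r hrU hr
      have hin : q r ∈ Ω := by
        refine h.ball_subset s hs ?_
        rw [mem_ball]
        refine lt_of_pow_lt_pow_left₀ 2 hρ.le ?_
        rw [dist_sq_coords e]
        simp only [hq, coord_symm_pt_zero, coord_symm_pt_one]
        have : (t + r * (e s 0 - t) - e s 0) ^ 2 + (g t + r * (e s 1 - g t) - e s 1) ^ 2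
            = (1 - r) ^ 2 * ρ ^ 2 := by rw [← hd2]; ring
        rw [this]
        have h1 : (1 - r) ^ 2 < 1 := by nlinarith [hr.1, hr.2]
        have h2 : 0 < ρ ^ 2 := by positivity
        nlinarith
      rw [c.mem_domain_iff _ hrU] at hin
      simp only [hq, coord_symm_pt_zero, coord_symm_pt_one] at hin
      rw [slope_def_field]
      apply div_nonneg _ (by linarith [hr.1])
      simp only [zero_mul, add_zero, sub_self, sub_zero]
      linarith
    have h0 := ge_of_tendsto ((hasDerivAt_iff_tendsto_slope.1 hφ).mono_left
      (nhdsWithin_mono _ (s := Ioi 0) fun r hr => ne_of_gt hr)) hpos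
    have h1 : (e s 1 - g t) - p * (e s 0 - t) = (e s 1 - g t) * w ^ 2 := by
      rw [hw2]; linear_combination (-p) * hcrit
    rw [h1] at h0
    exact nonneg_of_mul_nonneg_left h0 (by positivity)
  have h2 : (e s 1 - g t) * w = ρ := by
    have : ((e s 1 - g t) * w) ^ 2 = ρ ^ 2 := by
      rw [mul_pow, hw2, ← hd2]
      linear_combination (-(e s 0 - t) + (e s 1 - g t) * p) * hcrit
    exact (pow_left_inj₀ (mul_nonneg hsign hw0.le) hρ.le two_ne_zero).1 this
  have h3 : e s 1 - g t = ρ / w := by rw [eq_div_iff hw0.ne']; exact h2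
  constructor
  · have h4 : e s 0 = t - (ρ / w) * p := by rw [← h3]; linear_combination hcrit
    rw [h4, normalX]; ring
  · rw [normalY]; linarith

theorem coords_add_sub_eq {e : E2 ≃ᵃⁱ[ℝ] E2} {s y z : E2} (hm : s = midpoint ℝ y z) (i : Fin 2) :
    e z i = 2 * e s i - e y i := by
  have h1 : e s = midpoint ℝ (e y) (e z) := by
    rw [hm]; exact e.toAffineEquiv.map_midpoint y z
  have h2 : e y + e z = (2 : ℝ) • e s := by
    rw [h1, midpoint_eq_smul_add, smul_smul]; norm_num
  have h3 := congrArg (fun v : E2 => v i) h2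
  simp only [PiLp.add_apply, PiLp.smul_apply, smul_eq_mul] at h3
  linarith

/-- The closest-point correspondence is monotone. -/
theorem inner_coords_nonneg (e : E2 ≃ᵃⁱ[ℝ] E2) (hρ : 0 ≤ ρ) {s s' y y' : E2}
    (h1 : dist s y = ρ) (h2 : dist s' y' = ρ) (h3 : ρ ≤ dist s y') (h4 : ρ ≤ dist s' y) :
    0 ≤ (e y' 0 - e y 0) * (e s' 0 - e s 0) + (e y' 1 - e y 1) * (e s' 1 - e s 1) := by
  have a1 := congrArg (· ^ 2) h1
  have a2 := congrArg (· ^ 2) h2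
  have a3 := pow_le_pow_left₀ hρ h3 2
  have a4 := pow_le_pow_left₀ hρ h4 2
  simp only [dist_sq_coords e] at a1 a2 a3 a4
  linarith

/-- The point at distance `ρ` from `graphCurve e g t` on the upward normal. -/
def normalPoint (e : E2 ≃ᵃⁱ[ℝ] E2) (ρ : ℝ) (g : ℝ → ℝ) (t : ℝ) : E2 :=
  e.symm (pt (normalX ρ g t) (normalY ρ g t))

theorem eq_normalPoint (c : IsGraphChart Ω K e U g) (h : IsEquidistantRidge Ω K S ρ) {t : ℝ}
    (ht : graphCurve e g t ∈ U) {s : E2} (hs : s ∈ S) (hd : dist s (graphCurve e g t) = ρ) :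
    s = normalPoint e ρ g t := by
  obtain ⟨h0, h1⟩ := c.coords_of_dist_eq h ht hs hd
  apply e.injective
  rw [normalPoint, e.apply_symm_apply]
  exact E2.ext_coords h0 h1

theorem normalPoint_mem (c : IsGraphChart Ω K e U g) (h : IsEquidistantRidge Ω K S ρ) {t : ℝ}
    (ht : graphCurve e g t ∈ U) :
    normalPoint e ρ g t ∈ S ∧ dist (normalPoint e ρ g t) (graphCurve e g t) = ρ := by
  obtain ⟨s, hs, hd⟩ := h.exists_dist_eq _ (c.graphCurve_mem ht)
  rw [← c.eq_normalPoint h ht hs hd]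
  exact ⟨hs, hd⟩

theorem deriv_normalX_nonneg (c : IsGraphChart Ω K e U g) (h : IsEquidistantRidge Ω K S ρ)
    {t : ℝ} (ht : graphCurve e g t ∈ U) : 0 ≤ deriv (normalX ρ g) t := by
  have hev : ∀ᶠ x in 𝓝 t, 0 ≤ (x - t) * (normalX ρ g x - normalX ρ g t) +
      (g x - g t) * (normalY ρ g x - normalY ρ g t) := by
    filter_upwards [c.eventually_graphCurve_mem ht] with x hx
    have h1 := c.normalPoint_mem h ht
    have h2 := c.normalPoint_mem h hx
    have := inner_coords_nonneg e h.pos.le h1.2 h2.2 (h.le_dist h1.1 (c.graphCurve_mem hx))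
      (h.le_dist h2.1 (c.graphCurve_mem ht))
    simpa only [graphCurve, normalPoint, coord_symm_pt_zero, coord_symm_pt_one] using this
  have h3 := add_mul_deriv_nonneg (hasDerivAt_id t) (hasDerivAt_normalX c.contDiff ρ t)
    (c.contDiff.differentiable (by norm_num) t).hasDerivAt
    (hasDerivAt_normalY c.contDiff ρ t) hev
  have h4 : 0 ≤ deriv (normalX ρ g) t * (1 + deriv g t ^ 2) := by linarith
  exact nonneg_of_mul_nonneg_left h4 (by positivity)

theorem exists_locally_injective (c : IsGraphChart Ω K e U g)
    (h : IsEquidistantRidge Ω K S ρ) {t : ℝ} (ht : graphCurve e g t ∈ U)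
    (hX : deriv (normalX ρ g) t ≠ 0) :
    ∃ V, IsOpen V ∧ graphCurve e g t ∈ V ∧ V ⊆ U ∧ ∀ s ∈ S, ∀ y ∈ K, ∀ z ∈ K, y ∈ V → z ∈ V →
      dist s y = ρ → dist s z = ρ → y = z := by
  obtain ⟨ψ, -, hψ, -⟩ :=
    exists_contDiffAt_local_inverse (contDiff_normalX ρ c.contDiff) hX
  obtain ⟨N, hN, hNo, htN⟩ := _root_.eventually_nhds_iff.1 hψ
  refine ⟨U ∩ (fun z => e z 0) ⁻¹' N, c.isOpen.inter (hNo.preimage (continuous_coord e 0)),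
    ⟨ht, by rw [mem_preimage, graphCurve, coord_symm_pt_zero]; exact htN⟩, inter_subset_left, ?_⟩
  intro s hs y hy z hz hyV hzV hsy hsz
  have hy' := c.eq_graphCurve hy hyV.1
  have hz' := c.eq_graphCurve hz hzV.1
  have h1 := (c.coords_of_dist_eq h (hy' ▸ hyV.1) hs (hy' ▸ hsy)).1
  have h2 := (c.coords_of_dist_eq h (hz' ▸ hzV.1) hs (hz' ▸ hsz)).1
  have h3 : e y 0 = e z 0 :=
    (hN _ hyV.2).symm.trans ((congrArg ψ (h1.symm.trans h2)).trans (hN _ hzV.2))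
  rw [hy', hz', h3]

theorem eventually_nhds_closest_eq (c : IsGraphChart Ω K e U g)
    (h : IsEquidistantRidge Ω K S ρ) {t : ℝ} (ht : graphCurve e g t ∈ U)
    (hX : deriv (normalX ρ g) t ≠ 0) :
    ∀ᶠ y in 𝓝 (graphCurve e g t), y ∈ K → dist (normalPoint e ρ g t) y = ρ →
      y = graphCurve e g t := by
  obtain ⟨V, hVo, htV, -, hV⟩ := c.exists_locally_injective h ht hX
  filter_upwards [hVo.mem_nhds htV] with y hyV hy hd
  exact hV _ (c.normalPoint_mem h ht).1 y hy _ (c.graphCurve_mem ht) hyV htV hd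
    (c.normalPoint_mem h ht).2

theorem exists_eq_midpoint (c : IsGraphChart Ω K e U g) (h : IsEquidistantRidge Ω K S ρ) {t : ℝ}
    (ht : graphCurve e g t ∈ U) (hX : deriv (normalX ρ g) t ≠ 0) :
    ∃ z ∈ K, normalPoint e ρ g t = midpoint ℝ (graphCurve e g t) z := by
  obtain ⟨hs, hd⟩ := c.normalPoint_mem h ht
  obtain ⟨V, hVo, htV, -, hV⟩ := c.exists_locally_injective h ht hX
  by_cases hz : ∃ z ∈ K, dist (normalPoint e ρ g t) z = ρ ∧ z ≠ graphCurve e g t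
  · obtain ⟨z, hz, hzd, hne⟩ := hz
    exact ⟨z, hz, h.eq_midpoint _ hs _ (c.graphCurve_mem ht) z hz hd hzd hne
      (c.eventually_nhds_closest_eq h ht hX)⟩
  · push Not at hz
    have h1 := eventually_closest_mem h.isCompact (continuous_const (y := ρ)) hVo
      (s := normalPoint e ρ g t) fun y hy hd => by rw [hz y hy hd]; exact htV
    obtain ⟨s', ⟨hs', y, hy, z, hz, hyd, hzd, hne⟩, hall⟩ :=
      ((h.dense_multiple _ hs).and_eventually h1).exists
    exact absurd (hV s' hs' y hy z hz (hall y hy hyd) (hall z hz hzd) hyd hzd) hne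

/-- The parallel curve at distance `ρ` is either degenerate or uniformly regular. -/
theorem deriv_normalX_eq_zero_or (c : IsGraphChart Ω K e U g) (h : IsEquidistantRidge Ω K S ρ)
    {t : ℝ} (ht : graphCurve e g t ∈ U) :
    deriv (normalX ρ g) t = 0 ∨ 1 / 2 ≤ deriv (normalX ρ g) t := by
  by_cases hX : deriv (normalX ρ g) t = 0
  · exact Or.inl hX
  right
  have hXpos := lt_of_le_of_ne (c.deriv_normalX_nonneg h ht) (Ne.symm hX)
  have hXc : Continuous (deriv (normalX ρ g)) :=
    (contDiff_normalX ρ c.contDiff).continuous_deriv (by norm_num)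
  have hev : ∀ᶠ x in 𝓝 t, 0 ≤ ((2 * normalX ρ g x - x) - (2 * normalX ρ g t - t)) *
        (normalX ρ g x - normalX ρ g t) +
      ((2 * normalY ρ g x - g x) - (2 * normalY ρ g t - g t)) *
        (normalY ρ g x - normalY ρ g t) := by
    filter_upwards [c.eventually_graphCurve_mem ht,
      hXc.continuousAt.eventually_ne hX] with x hx hXx
    have h1 := c.normalPoint_mem h ht
    have h2 := c.normalPoint_mem h hx
    obtain ⟨z, hz, hzm⟩ := c.exists_eq_midpoint h ht hX
    obtain ⟨z', hz', hzm'⟩ := c.exists_eq_midpoint h hx hXx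
    have hd : ∀ s y z : E2, s = midpoint ℝ y z → dist s z = dist s y := by
      rintro s y z rfl
      rw [dist_midpoint_left, dist_midpoint_right]
    have := inner_coords_nonneg e h.pos.le ((hd _ _ _ hzm).trans h1.2) ((hd _ _ _ hzm').trans h2.2)
      (h.le_dist h1.1 hz') (h.le_dist h2.1 hz)
    simpa only [coords_add_sub_eq hzm, coords_add_sub_eq hzm', graphCurve, normalPoint,
      coord_symm_pt_zero, coord_symm_pt_one] using this
  have hX' := hasDerivAt_normalX c.contDiff ρ t
  have hY' := hasDerivAt_normalY c.contDiff ρ t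
  have hg' := (c.contDiff.differentiable (by norm_num) t).hasDerivAt
  have h3 := add_mul_deriv_nonneg ((hX'.const_mul 2).sub (hasDerivAt_id t)) hX'
    ((hY'.const_mul 2).sub hg') hY' hev
  have h4 : 0 ≤ (2 * deriv (normalX ρ g) t - 1) *
      (deriv (normalX ρ g) t * (1 + deriv g t ^ 2)) := by linarith
  have := nonneg_of_mul_nonneg_left h4 (by positivity)
  linarith

/-- Where the parallel curve is degenerate, the boundary is a circular arc. -/
theorem eventually_mem_iff_dist_eq (c : IsGraphChart Ω K e U g)
    (h : IsEquidistantRidge Ω K S ρ) {t : ℝ} (ht : graphCurve e g t ∈ U)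
    (hX : deriv (normalX ρ g) t = 0) :
    ∀ᶠ w in 𝓝 (graphCurve e g t), w ∈ K ↔ dist (normalPoint e ρ g t) w = ρ := by
  have hρ := h.pos
  have hXc : Continuous (deriv (normalX ρ g)) :=
    (contDiff_normalX ρ c.contDiff).continuous_deriv (by norm_num)
  have h1 : ∀ᶠ x in 𝓝 t, graphCurve e g x ∈ U ∧ deriv (normalX ρ g) x < 1 / 2 :=
    (c.eventually_graphCurve_mem ht).and
      (hXc.continuousAt.eventually_lt continuousAt_const (by rw [hX]; norm_num))
  obtain ⟨r, hr, hball⟩ := Metric.eventually_nhds_iff_ball.1 h1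
  have hX0 : ∀ x ∈ ball t r, deriv (normalX ρ g) x = 0 := fun x hx =>
    (c.deriv_normalX_eq_zero_or h (hball x hx).1).resolve_right (not_le.2 (hball x hx).2)
  have hpre : IsPreconnected (ball t r) := (convex_ball t r).isPreconnected
  have hXeq : ∀ x ∈ ball t r, normalX ρ g x = normalX ρ g t := fun x hx =>
    isOpen_ball.is_const_of_deriv_eq_zero hpre
      (fun x _ => (hasDerivAt_normalX c.contDiff ρ x).differentiableAt.differentiableWithinAt)
      (fun x hx => hX0 x hx) hx (mem_ball_self hr)
  have hYeq : ∀ x ∈ ball t r, normalY ρ g x = normalY ρ g t := fun x hx =>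
    isOpen_ball.is_const_of_deriv_eq_zero hpre
      (fun x _ => (hasDerivAt_normalY c.contDiff ρ x).differentiableAt.differentiableWithinAt)
      (fun x hx => by
        rw [(hasDerivAt_normalY c.contDiff ρ x).deriv, hX0 x hx, mul_zero]; rfl)
      hx (mem_ball_self hr)
  have hgY : ∀ x, g x < normalY ρ g x := fun x =>
    lt_add_of_pos_right _ (div_pos hρ (sqrt_one_add_sq_pos _))
  have hc0 : e (graphCurve e g t) 0 = t := coord_symm_pt_zero ..
  have hc1 : e (graphCurve e g t) 1 = g t := coord_symm_pt_one ..
  filter_upwards [c.isOpen.mem_nhds ht,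
    (isOpen_ball.preimage (continuous_coord e 0)).mem_nhds
      (show e (graphCurve e g t) 0 ∈ ball t r by rw [hc0]; exact mem_ball_self hr),
    (isOpen_Iio.preimage (continuous_coord e 1)).mem_nhds
      (show e (graphCurve e g t) 1 ∈ Iio (normalY ρ g t) by rw [hc1]; exact hgY t)]
    with w hwU hw0 hw1
  have hw0 : e w 0 ∈ ball t r := hw0
  have hw1 : e w 1 < normalY ρ g t := hw1
  have hnp : normalPoint e ρ g (e w 0) = normalPoint e ρ g t := by
    rw [normalPoint, normalPoint, hXeq _ hw0, hYeq _ hw0]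
  have hwd : dist (normalPoint e ρ g t) (graphCurve e g (e w 0)) = ρ := by
    rw [← hnp]; exact (c.normalPoint_mem h (hball _ hw0).1).2
  constructor
  · intro hw
    rw [c.eq_graphCurve hw hwU]; exact hwd
  · intro hw
    rw [c.mem_bd_iff w hwU]
    have h2 := congrArg (· ^ 2) (hw.trans hwd.symm)
    simp only [dist_sq_coords e] at h2
    simp only [normalPoint, graphCurve, coord_symm_pt_zero, coord_symm_pt_one] at h2
    have h3 := hgY (e w 0)
    rw [hYeq _ hw0] at h3
    have h4 : (normalY ρ g t - e w 1) ^ 2 = (normalY ρ g t - g (e w 0)) ^ 2 := by linarith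
    have h5 := (pow_left_inj₀ (by linarith) (by linarith) two_ne_zero).1 h4
    linarith

/-- Near a point where the parallel curve is regular, the boundary is nowhere a circular arc of
radius `ρ` centered on the ridge. -/
theorem eventually_frequently_dist_ne (c : IsGraphChart Ω K e U g)
    (h : IsEquidistantRidge Ω K S ρ) {t : ℝ} (ht : graphCurve e g t ∈ U)
    (hX : deriv (normalX ρ g) t ≠ 0) :
    ∀ᶠ y in 𝓝 (graphCurve e g t), y ∈ K → ∀ s ∈ S, dist s y = ρ →
      ∃ᶠ w in 𝓝 y, w ∈ K ∧ dist s w ≠ ρ := by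
  obtain ⟨V, hVo, htV, hVU, hV⟩ := c.exists_locally_injective h ht hX
  filter_upwards [hVo.mem_nhds htV] with y hyV hy s hs hd hev
  have hyc := c.eq_graphCurve hy (hVU hyV)
  have hUx := c.eventually_graphCurve_mem (hyc ▸ hVU hyV)
  have hcont : Tendsto (graphCurve e g) (𝓝 (e y 0)) (𝓝 y) := by
    have := c.continuous_graphCurve.tendsto (e y 0)
    rwa [← hyc] at this
  have h1 : ∀ᶠ x in 𝓝 (e y 0), x = e y 0 := by
    filter_upwards [hUx, hcont.eventually hev, hcont.eventually (hVo.mem_nhds hyV)]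
      with x hxU hx hxV
    have hxK := c.graphCurve_mem hxU
    have hxd : dist s (graphCurve e g x) = ρ := by
      by_contra hne
      exact hx ⟨hxK, hne⟩
    have := hV s hs _ hxK y hy hxV hyV hxd hd
    rw [← this, graphCurve, coord_symm_pt_zero]
  have h2 : ∀ᶠ x in 𝓝[≠] (e y 0), x = e y 0 := nhdsWithin_le_nhds h1
  obtain ⟨x, hx, hne⟩ := (h2.and self_mem_nhdsWithin).exists
  exact hne hx

/-- If antipodes of closest points are closest points, then near a point where the parallel curve
is regular all ridge points lie on the parallel curve. -/
theorem eventually_exists_closest_mem (c : IsGraphChart Ω K e U g)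
    (h : IsEquidistantRidge Ω K S ρ)
    (hanti : ∀ s ∈ S, ∀ y ∈ K, dist s y = ρ → ∃ z ∈ K, s = midpoint ℝ y z) {t : ℝ}
    (ht : graphCurve e g t ∈ U) (hX : deriv (normalX ρ g) t ≠ 0) {V : Set E2} (hV : IsOpen V)
    (htV : graphCurve e g t ∈ V) :
    ∀ᶠ s in 𝓝 (normalPoint e ρ g t), s ∈ S → ∃ y ∈ K, y ∈ V ∧ dist s y = ρ := by
  obtain ⟨hs, hd⟩ := c.normalPoint_mem h ht
  have hrefl : ∀ s y z : E2, s = midpoint ℝ y z → (2 : ℝ) • s - y = z ∧ (2 : ℝ) • s - z = y := by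
    rintro s y z rfl
    rw [midpoint_eq_smul_add, smul_smul]
    constructor <;> norm_num
  have hW : IsOpen {p : E2 × E2 | p.2 ∈ V ∨ (2 : ℝ) • p.1 - p.2 ∈ V} :=
    (hV.preimage continuous_snd).union
      (hV.preimage (f := fun p : E2 × E2 => (2 : ℝ) • p.1 - p.2) (by fun_prop))
  filter_upwards [eventually_forall_of_dist_eq h.isCompact (continuous_const (y := ρ)) hW
    (s := normalPoint e ρ g t) fun y hy hyd => by
      by_cases hne : y = graphCurve e g t
      · exact Or.inl (hne ▸ htV)
      · right
        have hm := h.eq_midpoint _ hs _ (c.graphCurve_mem ht) y hy hd hyd hne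
          (c.eventually_nhds_closest_eq h ht hX)
        show (2 : ℝ) • normalPoint e ρ g t - y ∈ V
        rw [(hrefl _ _ _ hm).2]
        exact htV] with s hall hsS
  obtain ⟨y, hy, hyd⟩ := h.exists_mem_dist_eq hsS
  rcases hall y hy hyd with hyV | hyV
  · exact ⟨y, hy, hyV, hyd⟩
  · obtain ⟨z, hz, hm⟩ := hanti s hsS y hy hyd
    have hyV : (2 : ℝ) • s - y ∈ V := hyV
    rw [(hrefl _ _ _ hm).1] at hyV
    refine ⟨z, hz, hyV, ?_⟩
    rw [← hyd, hm, dist_midpoint_left, dist_midpoint_right]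

theorem isC2GraphAt_normalPoint (c : IsGraphChart Ω K e U g) (h : IsEquidistantRidge Ω K S ρ)
    (hanti : ∀ s ∈ S, ∀ y ∈ K, dist s y = ρ → ∃ z ∈ K, s = midpoint ℝ y z) {t : ℝ}
    (ht : graphCurve e g t ∈ U) (hX : deriv (normalX ρ g) t ≠ 0) :
    IsC2GraphAt S (normalPoint e ρ g t) := by
  have hXC := contDiff_normalX ρ c.contDiff
  obtain ⟨ψ, hψ, hleft, hright⟩ := exists_contDiffAt_local_inverse hXC hX
  obtain ⟨H, hH, hHeq⟩ :=
    (contDiffAt_normalY_comp c.contDiff hψ hright).exists_contDiff_eventuallyEq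
  have hψt : ψ (normalX ρ g t) = t := hleft.self_of_nhds
  have hHt : H (normalX ρ g t) = normalY ρ g t := by
    rw [hHeq.self_of_nhds, Function.comp_apply, hψt]
  obtain ⟨N, hN, hNo, htN⟩ := _root_.eventually_nhds_iff.1
    (hleft.and (hXC.continuous.continuousAt.eventually hHeq))
  have hSgraph : ∀ᶠ s in 𝓝 (normalPoint e ρ g t), s ∈ S → e s 1 = H (e s 0) := by
    filter_upwards [c.eventually_exists_closest_mem h hanti ht hX
      (V := U ∩ (fun z => e z 0) ⁻¹' N) (c.isOpen.inter (hNo.preimage (continuous_coord e 0)))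
      ⟨ht, by rw [mem_preimage, graphCurve, coord_symm_pt_zero]; exact htN⟩] with s hs hsS
    obtain ⟨y, hy, ⟨hyU, hyN⟩, hyd⟩ := hs hsS
    have hyc := c.eq_graphCurve hy hyU
    obtain ⟨h0, h1⟩ := c.coords_of_dist_eq h (hyc ▸ hyU) hsS (hyc ▸ hyd)
    rw [h0, h1, (hN _ hyN).2, Function.comp_apply, (hN _ hyN).1]
  obtain ⟨V, hV, hVo, htV⟩ := _root_.eventually_nhds_iff.1 hSgraph
  have hcurve : ∀ᶠ v in 𝓝 (normalX ρ g t), normalX ρ g (ψ v) = v ∧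
      H v = normalY ρ g (ψ v) ∧ graphCurve e g (ψ v) ∈ U ∧ e.symm (pt v (H v)) ∈ V := by
    refine hright.and (hHeq.and (Filter.Eventually.and ?_ ?_))
    · refine hψ.continuousAt.eventually (p := fun x => graphCurve e g x ∈ U) ?_
      rw [hψt]
      exact c.eventually_graphCurve_mem ht
    · refine (hVo.preimage (continuous_symm_pt e continuous_id hH.continuous)).mem_nhds ?_
      show e.symm (pt (normalX ρ g t) (H (normalX ρ g t))) ∈ V
      rw [hHt]
      exact htV
  obtain ⟨δ, hδ, hball⟩ := Metric.eventually_nhds_iff_ball.1 hcurve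
  rw [Real.ball_eq_Ioo] at hball
  refine ⟨e, V ∩ (fun z => e z 0) ⁻¹' Ioo (normalX ρ g t - δ) (normalX ρ g t + δ), H,
    normalX ρ g t - δ, normalX ρ g t + δ,
    hVo.inter (isOpen_Ioo.preimage (continuous_coord e 0)), ⟨htV, ?_⟩, by linarith, hH, ?_⟩
  · rw [mem_preimage, normalPoint, coord_symm_pt_zero]
    constructor <;> linarith
  · ext z
    constructor
    · rintro ⟨s, ⟨hsS, hsV, hs0⟩, rfl⟩
      exact ⟨e s 0, hs0, E2.ext_coords rfl (hV s hsV hsS).symm⟩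
    · rintro ⟨v, hv, rfl⟩
      obtain ⟨h1, h2, h3, h4⟩ := hball v hv
      refine ⟨e.symm (pt v (H v)), ⟨?_, h4, ?_⟩, e.apply_symm_apply _⟩
      · have := (c.normalPoint_mem h h3).1
        rwa [normalPoint, h1, ← h2] at this
      · rw [mem_preimage, coord_symm_pt_zero]
        exact hv

end IsGraphChart

end Chart

section Conclusion

open Filter Topology

variable {Ω K S : Set E2} {ρ : ℝ}

theorem IsCkDomain2.exists_isGraphChart (hreg : IsCkDomain2 2 Ω) {y : E2}
    (hy : y ∈ frontier Ω) :
    ∃ e U g, IsGraphChart Ω (frontier Ω) e U g ∧ ∃ t, graphCurve e g t ∈ U ∧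
      y = graphCurve e g t := by
  obtain ⟨e, U, g, hU, hyU, hg, h1, h2⟩ := hreg y hy
  have c : IsGraphChart Ω (frontier Ω) e U g := ⟨hU, hg, h1, h2⟩
  have hyc := c.eq_graphCurve hy hyU
  exact ⟨e, U, g, c, e y 0, hyc ▸ hyU, hyc⟩

/-- If the boundary contains a circular arc of radius `ρ` centered at `s`, it contains the whole
circle. -/
theorem sphere_subset_frontier (hreg : IsCkDomain2 2 Ω)
    (h : IsEquidistantRidge Ω (frontier Ω) S ρ) {s y : E2} (hs : s ∈ S) (hy : dist s y = ρ)
    (hcirc : ∀ᶠ w in 𝓝 y, w ∈ frontier Ω ↔ dist s w = ρ) : sphere s ρ ⊆ frontier Ω := by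
  set D : Set E2 := {z | ∀ᶠ w in 𝓝 z, w ∈ frontier Ω ↔ dist s w = ρ} with hD
  have hDo : IsOpen D := isOpen_setOfPred_eventually_nhds
  have hconn : IsPreconnected (sphere s ρ) := by
    refine (isConnected_sphere ?_ s h.pos.le).isPreconnected
    rw [← Module.finrank_eq_rank, finrank_euclideanSpace_fin]
    norm_num
  have hcompl : ∀ z ∈ sphere s ρ, z ∉ D → ∀ᶠ w in 𝓝 z, w ∈ sphere s ρ → w ∉ D := by
    intro z hz hzD
    by_cases hzK : z ∈ frontier Ω
    · obtain ⟨e, U, g, c, t, ht, rfl⟩ := hreg.exists_isGraphChart hzK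
      have hsz : dist s (graphCurve e g t) = ρ := by rw [dist_comm]; exact hz
      have hsn := c.eq_normalPoint h ht hs hsz
      have hX : deriv (normalX ρ g) t ≠ 0 := by
        intro hX
        refine hzD ?_
        have := c.eventually_mem_iff_dist_eq h ht hX
        rwa [← hsn] at this
      filter_upwards [c.eventually_frequently_dist_ne h ht hX] with w hw hws hwD
      have hsw : dist s w = ρ := by rw [dist_comm]; exact hws
      have hwK : w ∈ frontier Ω := hwD.self_of_nhds.2 hsw
      refine hw hwK s hs hsw ?_
      filter_upwards [hwD] with x hx hx'
      exact hx'.2 (hx.1 hx'.1)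
    · filter_upwards [isClosed_frontier.isOpen_compl.mem_nhds hzK] with w hw hws hwD
      exact hw (hwD.self_of_nhds.2 (by rw [dist_comm]; exact hws))
  have hsub : sphere s ρ ⊆ D := by
    intro z hz
    by_contra hzD
    obtain ⟨x, hx, hxD, hxv⟩ := hconn D {z | ∀ᶠ w in 𝓝 z, w ∈ sphere s ρ → w ∉ D} hDo
      isOpen_setOfPred_eventually_nhds
      (fun z hz => (em (z ∈ D)).imp id (hcompl z hz))
      ⟨y, by rw [mem_sphere, dist_comm]; exact hy, hcirc⟩ ⟨z, hz, hcompl z hz hzD⟩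
    exact hxv.self_of_nhds hx hxD
  intro z hz
  exact (hsub hz).self_of_nhds.2 (by rw [dist_comm]; exact hz)

/-- A domain whose boundary contains a sphere of radius `ρ` centered on the ridge is a disk. -/
theorem eq_singleton_of_sphere_subset (hconn : IsPreconnected Ω)
    (h : IsEquidistantRidge Ω (frontier Ω) S ρ) {s : E2} (hs : s ∈ S)
    (hsub : sphere s ρ ⊆ frontier Ω) : S = {s} := by
  have hmem : ∀ s' ∈ S, s' ∈ Ω := fun s' hs' => h.ball_subset s' hs' (mem_ball_self h.pos)
  have hball : Ω ⊆ ball s ρ :=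
    hconn.subset_of_disjoint_frontier isOpen_ball
      (h.disjoint.mono_right (frontier_ball_subset_sphere.trans hsub))
      ⟨s, hmem s hs, mem_ball_self h.pos⟩
  refine eq_singleton_iff_unique_mem.2 ⟨hs, fun s' hs' => ?_⟩
  by_contra hne
  have hpos : 0 < ‖s' - s‖ := norm_pos_iff.2 (sub_ne_zero.2 hne)
  have hlt : ‖s' - s‖ < ρ := by simpa [dist_eq_norm] using hball (hmem s' hs')
  have hy : s + (ρ / ‖s' - s‖) • (s' - s) ∈ sphere s ρ := by
    rw [mem_sphere, dist_eq_norm, add_sub_cancel_left, norm_smul, Real.norm_eq_abs,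
      abs_of_pos (div_pos h.pos hpos), div_mul_cancel₀ _ hpos.ne']
  have h1 := h.le_dist hs' (hsub hy)
  have h2 : s' - (s + (ρ / ‖s' - s‖) • (s' - s)) = (1 - ρ / ‖s' - s‖) • (s' - s) := by
    module
  rw [dist_eq_norm, h2, norm_smul, Real.norm_eq_abs,
    abs_of_neg (sub_neg.2 ((one_lt_div hpos).2 hlt)), neg_sub, sub_mul, one_mul,
    div_mul_cancel₀ _ hpos.ne'] at h1
  linarith

/-- A ridge no point of which is the center of a boundary arc of radius `ρ` is a `C²` curve. -/
theorem isC2GraphAt_of_forall_not_eventually (hreg : IsCkDomain2 2 Ω)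
    (h : IsEquidistantRidge Ω (frontier Ω) S ρ)
    (hdeg : ∀ s ∈ S, ∀ y, dist s y = ρ → ¬ ∀ᶠ w in 𝓝 y, w ∈ frontier Ω ↔ dist s w = ρ)
    {p : E2} (hp : p ∈ S) : IsC2GraphAt S p := by
  have hX : ∀ {e U g}, IsGraphChart Ω (frontier Ω) e U g → ∀ {t}, graphCurve e g t ∈ U →
      deriv (normalX ρ g) t ≠ 0 := fun c t ht hX =>
    hdeg _ (c.normalPoint_mem h ht).1 _ (c.normalPoint_mem h ht).2
      (c.eventually_mem_iff_dist_eq h ht hX)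
  obtain ⟨y, hy, hd⟩ := h.exists_mem_dist_eq hp
  obtain ⟨e, U, g, c, t, ht, rfl⟩ := hreg.exists_isGraphChart hy
  rw [c.eq_normalPoint h ht hp hd]
  refine c.isC2GraphAt_normalPoint h (fun s hs y hy hd => ?_) ht (hX c ht)
  obtain ⟨e, U, g, c, t, ht, rfl⟩ := hreg.exists_isGraphChart hy
  rw [c.eq_normalPoint h ht hs hd]
  exact c.exists_eq_midpoint h ht (hX c ht)

end Conclusion

/-- **Theorem.** Let `Ω ⊂ ℝ²` be a nonempty open bounded connected domain of class `C²`
whose high ridge and cut locus coincide, `S := H(Ω) = Cut(Ω)`. Then `S` is either a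
singleton or a `1`-dimensional manifold without boundary of class `C²`, and `Ω` is the
open `ρ_Ω`-tubular neighborhood of `S`. -/
theorem stmt5 (Ω : Set E2) (hne : Ω.Nonempty) (hop : IsOpen Ω)
    (hbd : Bornology.IsBounded Ω) (hconn : IsConnected Ω)
    (hreg : IsCkDomain2 2 Ω)
    (S : Set E2) (hS : S = highRidge Ω) (hScut : highRidge Ω = cutLocus Ω) :
    ((∃ p, S = {p}) ∨ (∀ p ∈ S, IsC2GraphAt S p)) ∧
    Ω = {x | infDist x S < inradius Ω} := by
  subst hS
  have h := isEquidistantRidge_highRidge hne hop hbd hScut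
  refine ⟨?_, eq_setOf_infDist_highRidge_lt hne hop hbd hScut⟩
  by_cases hdeg : ∃ s ∈ highRidge Ω, ∃ y, dist s y = inradius Ω ∧
      ∀ᶠ w in nhds y, w ∈ frontier Ω ↔ dist s w = inradius Ω
  · obtain ⟨s, hs, y, hy, hcirc⟩ := hdeg
    exact Or.inl ⟨s, eq_singleton_of_sphere_subset hconn.isPreconnected h hs
      (sphere_subset_frontier hreg h hs hy hcirc)⟩
  · exact Or.inr fun p hp => isC2GraphAt_of_forall_not_eventually hreg h
      (fun s hs y hy hcirc => hdeg ⟨s, hs, y, hy, hcirc⟩) hp
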